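/- For all parking functions a ∈ P_m and b ∈ P_n, Δ(M_a ⋆ M_b) = Δ(M_a) ⋆ Δ(M_b); that is, the coproduct Δ is an algebra morphism from (KP, ⋆) to (KP ⊗ KP) with its componentwise product. -/

import Mathlib

open scoped Classical

/-- Words on natural numbers (letters are intended to be positive integers). -/
abbrev W : Type := List ℕ

/-- `IsPF a` : the word `a` is a parking function, i.e. all its letters are
positive and its nondecreasing rearrangement `b₁ b₂ ⋯ bₙ` satisfies `bᵢ ≤ i`. -/
def IsPF (a : W) : Prop :=
  (∀ x ∈ a, 1 ≤ x) ∧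
    ∀ i, i < a.length → (a.insertionSort (· ≤ ·)).getD i 0 ≤ i + 1

/-- Split a word into the consecutive segments beginning at its
left-to-right minima (in the order in which they occur in the word). -/
def segs : W → List W
  | [] => []
  | x :: xs =>
      (x :: xs.takeWhile fun y => x ≤ y) :: segs (xs.dropWhile fun y => x ≤ y)
termination_by a => a.length
decreasing_by
  simpa using Nat.lt_succ_of_le (List.dropWhile_sublist _).length_le

/-- The LR-decomposition `F_a` of a word `a`: the sequence of segments beginning
at the left-to-right minima, listed in increasing order of their minimal letters
(i.e. in reverse order of occurrence in `a`). -/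
def LR (a : W) : List W := (segs a).reverse

/-- The word `w_k ⋯ w_2 w_1` encoded by an LR-decomposition `(w_1, …, w_k)`. -/
def wordOf (F : List W) : W := F.reverse.flatten

/-- A word is dominated if it is nonempty and its first letter is its minimal letter. -/
def Dominated (w : W) : Prop := w ≠ [] ∧ ∀ x ∈ w, w.headD 0 ≤ x

/-- The minimal letter of a word (`0` for the empty word). -/
def minW (w : W) : ℕ := (w.min?).getD 0

/-- Add `m` to every letter of a word. -/
def shiftW (m : ℕ) (w : W) : W := w.map (· + m)

/-- Add `m` to every letter of every word of a sequence of words. -/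
def shiftF (m : ℕ) (F : List W) : List W := F.map (shiftW m)

/-- The word whose LR-decomposition is the finite set of words `G`:
sort `G` increasingly (for dominated words with distinct minimal letters the
lexicographic order agrees with comparing the minimal letters) and concatenate
in decreasing order. -/
noncomputable def wordOfSet (G : Finset W) : W := (G.sort (· ≤ ·)).reverse.flatten

/-- Given vertex sets `X`, `Y` (of words) and a set `Θ` of edges, the resulting
set of words: concatenations `u ++ w` over edges `(u, w) ∈ Θ`, together with all
unmatched words of `X` and of `Y`. -/
noncomputable def glueSet (X Y : Finset W) (Θ : Finset (W × W)) : Finset W :=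
  Θ.image (fun p => p.1 ++ p.2) ∪
    X.filter (fun u => ∀ p ∈ Θ, p.1 ≠ u) ∪
    Y.filter (fun w => ∀ p ∈ Θ, p.2 ≠ w)

/-- `R(a,b)` : the set of matchings between `F_a` and `F_b + m` (`m` the length
of `a`), encoded as sets of edges in which no vertex occurs twice. -/
noncomputable def Rset (a b : W) : Finset (Finset (W × W)) :=
  ((LR a).toFinset ×ˢ (shiftF a.length (LR b)).toFinset).powerset.filter
    (fun Θ => ∀ p ∈ Θ, ∀ q ∈ Θ, (p.1 = q.1 ∨ p.2 = q.2) → p = q)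

/-- `aΘb` : the parking function whose LR-decomposition consists of the
concatenations `u ⬝ (w + m)` over the edges `(u, w + m)` of `Θ` together with all
unmatched words of `F_a` and of `F_b + m`. -/
noncomputable def mTheta (a b : W) (Θ : Finset (W × W)) : W :=
  wordOfSet (glueSet (LR a).toFinset (shiftF a.length (LR b)).toFinset Θ)

/-- `d(a) = min { i : #{ j : a_j ≤ i } < i }`. -/
def dVal (a : W) : ℕ :=
  Nat.find (p := fun i => (a.filter (fun x => x ≤ i)).length < i)
    ⟨a.length + 1, Nat.lt_succ_of_le (List.length_filter_le _ _)⟩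

/-- One step of the parkization algorithm: decrement every letter greater
than `d(a)`.  (This is the identity when `a` is a parking function.) -/
def parkStep (a : W) : W := a.map fun x => if dVal a < x then x - 1 else x

/-- Auxiliary fueled version of the parkization algorithm. -/
def parkFuel : ℕ → W → W
  | 0, a => a
  | k + 1, a => if dVal a = a.length + 1 then a else parkFuel k (parkStep a)

/-- The parkization `Park a` of a word `a`.  (For a word with positive letters
the algorithm needs at most `a.sum` steps, so the fuel below suffices.) -/
def Park (a : W) : W := parkFuel a.sum a

/-- The subword of `a` obtained by keeping exactly the words of `F_a`
belonging to `S`. -/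
def subWord (a : W) (S : Finset W) : W := wordOf ((LR a).filter (· ∈ S))

/-- The free module with basis indexed by words; the Hopf algebra `PFSym` is
its submodule spanned by `{M_a : a ∈ P}`. -/
abbrev FW (K : Type) [Field K] : Type := W →₀ K

/-- The monomial basis element `M_a`. -/
noncomputable def Mb (K : Type) [Field K] (a : W) : FW K := Finsupp.single a 1

/-- `M_a ⋆ M_b = Σ_{Θ ∈ R(a,b)} M_{aΘb}` on basis elements. -/
noncomputable def mulSingle (K : Type) [Field K] (a b : W) : FW K :=
  ∑ Θ ∈ Rset a b, Mb K (mTheta a b Θ)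

/-- The product `⋆`, extended bilinearly. -/
noncomputable def starF (K : Type) [Field K] (x y : FW K) : FW K :=
  x.sum fun a ca => y.sum fun b cb => (ca * cb) • mulSingle K a b

/-- The free module with basis indexed by pairs of words; it realizes the
tensor square of `FW K` via `M_a ⊗ M_b ↦ single (a,b)`. -/
abbrev FW2 (K : Type) [Field K] : Type := (W × W) →₀ K

/-- `Δ(M_a) = Σ M_{Park a'} ⊗ M_{Park a''}` over ordered pairs `(a', a'')` of
subwords of `a` with `F_{a'} ⊍ F_{a''} = F_a` (encoded by the subset
`S ⊆ F_a` of words kept in `a'`). -/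
noncomputable def deltaSingle (K : Type) [Field K] (a : W) : FW2 K :=
  ∑ S ∈ ((LR a).toFinset).powerset,
    Finsupp.single
      (Park (subWord a S), Park (subWord a (((LR a).toFinset) \ S))) 1

/-- The coproduct `Δ`, extended linearly. -/
noncomputable def deltaF (K : Type) [Field K] (x : FW K) : FW2 K :=
  x.sum fun a ca => ca • deltaSingle K a

/-- The componentwise product on the tensor square, on basis elements:
`(M_a ⊗ M_b) ⋆ (M_c ⊗ M_d) = (M_a ⋆ M_c) ⊗ (M_b ⋆ M_d)`. -/
noncomputable def star2Single (K : Type) [Field K] (p q : W × W) : FW2 K :=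
  ∑ Θ ∈ Rset p.1 q.1, ∑ Θ' ∈ Rset p.2 q.2,
    Finsupp.single (mTheta p.1 q.1 Θ, mTheta p.2 q.2 Θ') 1

/-- The componentwise product on the tensor square, extended bilinearly. -/
noncomputable def star2F (K : Type) [Field K] (x y : FW2 K) : FW2 K :=
  x.sum fun p cp => y.sum fun q cq => (cp * cq) • star2Single K p q

/-- The counit `ε` on basis elements. -/
noncomputable def epsW (K : Type) [Field K] (a : W) : K := if a = [] then 1 else 0

/-- `F_a ∘ F_b` : concatenate the `i`-th words of `F_a` and `F_b + m`
for `i ≤ min(r,s)` and keep the remaining unpaired words. -/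
def splitLR (F G : List W) : List W :=
  List.zipWith (· ++ ·) F G ++ F.drop G.length ++ G.drop F.length

/-- The split product `a ∘ b`. -/
def splitProd (a b : W) : W := wordOf (splitLR (LR a) (shiftF a.length (LR b)))

/-- A nonempty parking function is unsplitable if it is not the split product
of two nonempty parking functions. -/
def UnsplitablePF (a : W) : Prop :=
  IsPF a ∧ a ≠ [] ∧
    ¬ ∃ b c : W, IsPF b ∧ IsPF c ∧ b ≠ [] ∧ c ≠ [] ∧ a = splitProd b c

/-- The slash product `a | b = (b₁+m) ⋯ (bₙ+m) a₁ ⋯ a_m`. -/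
def slashProd (a b : W) : W := shiftW a.length b ++ a

/-- A nonempty parking function is atomic if it is not the slash product
of two nonempty parking functions. -/
def AtomicPF (a : W) : Prop :=
  IsPF a ∧ a ≠ [] ∧
    ¬ ∃ b c : W, IsPF b ∧ IsPF c ∧ b ≠ [] ∧ c ≠ [] ∧ a = slashProd b c

/-- `u ≺* v` : either `v` is a proper initial subword of `u`, or `u` is not a
proper initial subword of `v` and `u` precedes `v` lexicographically. -/
def precStar (u v : W) : Prop :=
  (v <+: u ∧ v ≠ u) ∨ (¬ (u <+: v ∧ u ≠ v) ∧ List.Lex (· < ·) u v)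

/-- `a ≺*_lex b` : `F_a` strictly precedes `F_b` in the lexicographic order
on sequences of words induced by `≺*`. -/
def precStarLex (a b : W) : Prop := List.Lex precStar (LR a) (LR b)

/-- The covering relation of `≤_*` : `b` covers `a` if `F_b` is obtained from
`F_a = (w_1, …, w_r)` by replacing `w_i` by `w_i ⬝ w_j` and removing `w_j`,
for some `i < j` such that every letter of `w_i` is at most every letter of `w_j`. -/
def CovStar (a b : W) : Prop :=
  ∃ i j, i < j ∧ j < (LR a).length ∧
    (∀ x ∈ (LR a).getD i [], ∀ y ∈ (LR a).getD j [], x ≤ y) ∧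
    LR b = ((LR a).set i ((LR a).getD i [] ++ (LR a).getD j [])).eraseIdx j

/-- The partial order `≤_*` on parking functions, generated by the covering
relations. -/
def leStar (a b : W) : Prop := Relation.ReflTransGen CovStar a b

/-- The finite set of all parking functions of length `n`. -/
noncomputable def pfFinset (n : ℕ) : Finset W :=
  ((Finset.univ : Finset (Fin n → Fin n)).image
      (fun f => List.ofFn fun i => (f i).val + 1)).filter IsPF

/-- The basis element `Q_a = Σ_{a ≤_* b} M_b`. -/
noncomputable def Qb (K : Type) [Field K] (a : W) : FW K :=
  ∑ b ∈ (pfFinset a.length).filter (fun b => leStar a b), Mb K b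

/-- `Q_x ⊗ Q_y` as an element of the tensor square. -/
noncomputable def QT (K : Type) [Field K] (x y : W) : FW2 K :=
  ∑ b ∈ (pfFinset x.length).filter (fun b => leStar x b),
    ∑ c ∈ (pfFinset y.length).filter (fun c => leStar y c),
      Finsupp.single (b, c) 1

/-- `a` is a nonincreasing word. -/
def NonInc (a : W) : Prop := a.Chain' (fun x y => y ≤ x)

/-- Every word of the LR-decomposition of `a` is nondecreasing. -/
def Nprop (a : W) : Prop := ∀ w ∈ LR a, w.Chain' (· ≤ ·)

/-- The words of the LR-decomposition of `a` have pairwise disjoint sets of letters. -/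
def Dprop (a : W) : Prop := (LR a).Pairwise (fun u v => ∀ x ∈ u, x ∉ v)

/-- `a` is a permutation of `{1, …, n}` viewed as a word. -/
def Sprop (a : W) : Prop := a.Perm (List.range' 1 a.length)



/-- number of letters at most `i` -/
def nc (w : W) (i : ℕ) : ℕ := w.countP (fun x => x ≤ i)

/-- total shift applied by parkization to the letter `x` -/
def dsh (w : W) (x : ℕ) : ℕ := (Finset.range x).sup (fun i => i - nc w i)

/-- the letter map realized by parkization -/
def pk (w : W) (x : ℕ) : ℕ := x - dsh w x

lemma nc_perm {u v : W} (h : u.Perm v) (i : ℕ) : nc u i = nc v i := h.countP_eq _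

lemma pk_perm {u v : W} (h : u.Perm v) : pk u = pk v := by
  funext x
  simp only [pk, dsh, nc_perm h]

lemma dsh_le {w : W} {x k : ℕ} : dsh w x ≤ k ↔ ∀ i < x, i - nc w i ≤ k := by
  simp [dsh]

lemma le_dsh (w : W) {x i : ℕ} (h : i < x) : i - nc w i ≤ dsh w x := dsh_le.1 le_rfl i h

lemma nc_mono (w : W) {i j : ℕ} (h : i ≤ j) : nc w i ≤ nc w j := by
  apply List.countP_mono_left
  intro x _ hx
  simp at *
  omega

lemma nc_lt {w : W} {i j x : ℕ} (hx : x ∈ w) (h : i < x) (h2 : x ≤ j) : nc w i < nc w j := by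
  induction w with
  | nil => simp at hx
  | cons y t ih =>
    have hm := nc_mono t (show i ≤ j by omega)
    simp only [nc, List.countP_cons] at *
    rcases List.mem_cons.1 hx with rfl | hx
    · simp [h2, Nat.not_le.2 h]; omega
    · have := ih hx
      by_cases h3 : y ≤ i
      · simp [h3, show y ≤ j by omega]; omega
      · simp [h3]; omega

lemma pk_lt {w : W} {x y : ℕ} (hx : x ∈ w) (h1 : 1 ≤ x) (h : x < y) : pk w x < pk w y := by
  have hd : dsh w x ≤ x - 1 := dsh_le.2 (fun i hi => by omega)
  have : dsh w y ≤ dsh w x + (y - x - 1) := by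
    rw [dsh_le]
    intro i hi
    by_cases hix : i < x
    · have := le_dsh w hix; omega
    · have h2 := nc_lt (i := x - 1) (j := i) hx (by omega) (by omega)
      have h3 := le_dsh w (i := x - 1) (x := x) (by omega)
      omega
  unfold pk; omega

lemma pk_pos {w : W} {x : ℕ} (h1 : 1 ≤ x) : 1 ≤ pk w x := by
  have hd : dsh w x ≤ x - 1 := dsh_le.2 (fun i hi => by omega)
  unfold pk; omega

lemma dVal_spec (w : W) : nc w (dVal w) < dVal w := by
  have := Nat.find_spec (p := fun i => (w.filter (fun x => x ≤ i)).length < i)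
    ⟨w.length + 1, Nat.lt_succ_of_le (List.length_filter_le _ _)⟩
  rw [← List.countP_eq_length_filter] at this
  exact this

lemma dVal_min (w : W) {i : ℕ} (h : i < dVal w) : i ≤ nc w i := by
  have := Nat.find_min (p := fun i => (w.filter (fun x => x ≤ i)).length < i)
    ⟨w.length + 1, Nat.lt_succ_of_le (List.length_filter_le _ _)⟩ h
  rw [← List.countP_eq_length_filter] at this
  simpa [nc] using this

lemma dVal_le (w : W) : dVal w ≤ w.length + 1 := by
  by_contra h
  have := dVal_min w (i := w.length + 1) (by omega)
  have h2 : nc w (w.length + 1) ≤ w.length := List.countP_le_length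
  omega

lemma dsh_zero (w : W) {x : ℕ} (h : x ≤ dVal w) : dsh w x = 0 := by
  apply Nat.le_zero.1
  rw [dsh_le]
  intro i hi
  have := dVal_min w (i := i) (by omega)
  omega

lemma nc_step_lt (w : W) {i : ℕ} (h : i < dVal w) : nc (parkStep w) i = nc w i := by
  unfold nc parkStep
  rw [List.countP_map]
  apply List.countP_congr
  intro x _
  simp only [Function.comp, decide_eq_true_eq]
  split <;> omega

lemma nc_step_ge (w : W) {i : ℕ} (h : dVal w ≤ i) : nc (parkStep w) i = nc w (i + 1) := by
  unfold nc parkStep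
  rw [List.countP_map]
  apply List.countP_congr
  intro x _
  simp only [Function.comp, decide_eq_true_eq]
  split <;> omega

lemma pk_step (w : W) (x : ℕ) :
    pk (parkStep w) (if dVal w < x then x - 1 else x) = pk w x := by
  have hs := dVal_spec w
  have hmin : ∀ i, i < dVal w → i ≤ nc w i := fun i => dVal_min w
  split
  · rename_i hx
    have h1 : 1 ≤ dsh w x := by
      have := le_dsh w hx; omega
    have : dsh (parkStep w) (x - 1) = dsh w x - 1 := by
      apply le_antisymm
      · rw [dsh_le]
        intro i hi
        by_cases hd : i < dVal w
        · rw [nc_step_lt w hd]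
          have := hmin i hd; omega
        · rw [nc_step_ge w (by omega)]
          have := le_dsh w (i := i + 1) (x := x) (by omega)
          omega
      · have : dsh w x ≤ dsh (parkStep w) (x - 1) + 1 := by
          rw [dsh_le]
          intro i hi
          rcases lt_trichotomy i (dVal w) with hd | hd | hd
          · have := hmin i hd; omega
          · subst hd
            have := hmin (dVal w - 1) (by omega)
            have h3 := nc_mono w (show dVal w - 1 ≤ dVal w by omega)
            omega
          · have := le_dsh (parkStep w) (i := i - 1) (x := x - 1) (by omega)
            rw [nc_step_ge w (by omega), show i - 1 + 1 = i by omega] at this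
            omega
        omega
    unfold pk; rw [this]; omega
  · rename_i hx
    unfold pk
    rw [dsh_zero w (by omega)]
    have : dsh (parkStep w) x = 0 := by
      apply Nat.le_zero.1
      rw [dsh_le]
      intro i hi
      rw [nc_step_lt w (by omega)]
      have := hmin i (by omega); omega
    rw [this]

lemma letters_le {w : W} (h : w.length ≤ nc w w.length) : ∀ x ∈ w, x ≤ w.length := by
  have : w.countP (fun x => x ≤ w.length) = w.length :=
    le_antisymm List.countP_le_length h
  rw [List.countP_eq_length] at this
  simpa using this

lemma map_pk_of_dVal {w : W} (h : dVal w = w.length + 1) : w.map (pk w) = w := by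
  have hl := letters_le (dVal_min w (i := w.length) (by omega))
  conv_rhs => rw [← List.map_id w]
  apply List.map_congr_left
  intro x hx
  have := hl x hx
  simp [pk, dsh_zero w (x := x) (by omega)]

lemma sum_step_le (d : ℕ) (w : W) :
    (w.map fun x => if d < x then x - 1 else x).sum ≤ w.sum ∧
    ((∃ x ∈ w, d < x) → (w.map fun x => if d < x then x - 1 else x).sum < w.sum) := by
  induction w with
  | nil => simp
  | cons y t ih =>
    obtain ⟨h1, h2⟩ := ih
    simp only [List.map_cons, List.sum_cons]
    constructor
    · split <;> omega
    · rintro ⟨x, hx, hd⟩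
      rcases List.mem_cons.1 hx with rfl | hx
      · simp [hd]; omega
      · have := h2 ⟨x, hx, hd⟩
        split <;> omega

lemma sum_parkStep {w : W} (h : dVal w ≠ w.length + 1) : (parkStep w).sum < w.sum := by
  apply (sum_step_le (dVal w) w).2
  by_contra hc
  push Not at hc
  have : nc w (dVal w) = w.length := by
    unfold nc
    rw [List.countP_eq_length]
    simpa using hc
  have := dVal_spec w
  have := dVal_le w
  omega

lemma parkFuel_eq (k : ℕ) : ∀ w : W, w.sum ≤ k → (∀ x ∈ w, 1 ≤ x) →
    parkFuel k w = w.map (pk w) := by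
  induction k with
  | zero =>
    intro w h hp
    have : w = [] := by
      rcases w with _ | ⟨x, t⟩
      · rfl
      · have := hp x (by simp)
        simp at h; omega
    subst this; simp [parkFuel]
  | succ k ih =>
    intro w h hp
    unfold parkFuel
    split
    · rename_i hd
      exact (map_pk_of_dVal hd).symm
    · rename_i hd
      have hs := sum_parkStep hd
      rw [ih (parkStep w) (by omega)]
      · conv_lhs => arg 2; unfold parkStep
        rw [List.map_map]
        apply List.map_congr_left
        intro x _
        exact pk_step w x
      · have := dVal_spec w
        unfold parkStep
        intro y hy
        obtain ⟨x, hx, rfl⟩ := List.mem_map.1 hy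
        have := hp x hx
        split <;> omega

lemma Park_eq {w : W} (hp : ∀ x ∈ w, 1 ≤ x) : Park w = w.map (pk w) :=
  parkFuel_eq _ w le_rfl hp

lemma nc_append (u v : W) (i : ℕ) : nc (u ++ v) i = nc u i + nc v i := by
  simp [nc]

lemma nc_shift_lt (m : ℕ) (v : W) {i : ℕ} (hv : ∀ x ∈ v, 1 ≤ x) (h : i ≤ m) :
    nc (shiftW m v) i = 0 := by
  unfold nc shiftW
  rw [List.countP_map, List.countP_eq_zero]
  intro x hx
  have := hv x hx
  simp; omega

lemma nc_shift_ge (m : ℕ) (v : W) (j : ℕ) : nc (shiftW m v) (m + j) = nc v j := by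
  unfold nc shiftW
  rw [List.countP_map]
  apply List.countP_congr
  intro x _
  simp; omega

lemma nc_full {u : W} {m i : ℕ} (hu : ∀ x ∈ u, x ≤ m) (h : m ≤ i) : nc u i = u.length := by
  unfold nc
  rw [List.countP_eq_length]
  intro x hx
  have := hu x hx
  simp; omega

lemma pk_left {u v : W} {m x : ℕ} (hv : ∀ x ∈ v, 1 ≤ x) (hx : x ≤ m) :
    pk (u ++ shiftW m v) x = pk u x := by
  have : dsh (u ++ shiftW m v) x = dsh u x := by
    unfold dsh
    apply Finset.sup_congr rfl
    intro i hi
    simp at hi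
    rw [nc_append, nc_shift_lt m v hv (by omega)]
    simp
  rw [pk, pk, this]

lemma pk_right {u v : W} {m y : ℕ} (hu : ∀ x ∈ u, x ≤ m) (hv : ∀ x ∈ v, 1 ≤ x)
    (hk : u.length ≤ m) (hc : ∀ i ≤ m, i - nc u i ≤ m - u.length) (hy : 1 ≤ y) :
    pk (u ++ shiftW m v) (y + m) = pk v y + u.length := by
  have hd : dsh v y ≤ y - 1 := dsh_le.2 (fun i hi => by omega)
  have : dsh (u ++ shiftW m v) (y + m) = (m - u.length) + dsh v y := by
    apply le_antisymm
    · rw [dsh_le]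
      intro i hi
      rw [nc_append]
      by_cases him : i ≤ m
      · rw [nc_shift_lt m v hv him]
        have := hc i him; omega
      · obtain ⟨j, rfl⟩ := Nat.exists_eq_add_of_le (show m ≤ i by omega)
        rw [nc_shift_ge, nc_full hu (by omega)]
        have := le_dsh v (i := j) (x := y) (by omega)
        omega
    · have h0 := le_dsh (u ++ shiftW m v) (i := m) (x := y + m) (by omega)
      rw [nc_append, nc_shift_lt m v hv le_rfl, nc_full hu le_rfl] at h0
      have : dsh v y ≤ dsh (u ++ shiftW m v) (y + m) - (m - u.length) := by
        rw [dsh_le]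
        intro j hj
        have := le_dsh (u ++ shiftW m v) (i := m + j) (x := y + m) (by omega)
        rw [nc_append, nc_shift_ge, nc_full hu (by omega)] at this
        omega
      omega
  unfold pk
  rw [this]; omega

lemma pf_count {a : W} (ha : IsPF a) {i : ℕ} (hi : i ≤ a.length) : i ≤ nc a i := by
  rw [← nc_perm (List.perm_insertionSort (· ≤ ·) a) i]
  set s := a.insertionSort (· ≤ ·) with hs
  have hl : s.length = a.length := List.length_insertionSort _ _
  have h1 : nc s i ≥ nc (s.take i) i := (List.take_sublist i s).countP_le
  have h2 : nc (s.take i) i = (s.take i).length := by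
    unfold nc
    rw [List.countP_eq_length]
    intro x hx
    obtain ⟨j, hj, rfl⟩ := List.mem_iff_getElem.1 hx
    have hj' : j < i := by simp at hj; omega
    have := ha.2 j (by omega)
    rw [← hs, List.getD_eq_getElem _ _ (by omega)] at this
    simp; omega
  simp at h2
  omega

lemma pf_le {a : W} (ha : IsPF a) : ∀ x ∈ a, x ≤ a.length := letters_le (pf_count ha le_rfl)

lemma sub_count {a u : W} (ha : IsPF a) (hu : u.Sublist a) :
    ∀ i ≤ a.length, i - nc u i ≤ a.length - u.length := by
  intro i hi
  obtain ⟨l, hl⟩ := hu.exists_perm_append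
  have h1 := pf_count ha hi
  rw [nc_perm hl, nc_append] at h1
  have h2 : nc l i ≤ l.length := List.countP_le_length
  have := hl.length_eq
  simp at this
  omega

/-- comparison of nonempty words by first letters -/
def hlt (u v : W) : Prop := u ≠ [] ∧ v ≠ [] ∧ u.headD 0 < v.headD 0

/-- sets of dominated words with distinct first letters -/
def Good (G : Finset W) : Prop :=
  (∀ w ∈ G, Dominated w) ∧ ∀ u ∈ G, ∀ v ∈ G, u.headD 0 = v.headD 0 → u = v

lemma hlt_lt {u v : W} (h : hlt u v) : u < v := by
  obtain ⟨h1, h2, h3⟩ := h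
  rcases u with _ | ⟨x, u⟩
  · simp at h1
  rcases v with _ | ⟨y, v⟩
  · simp at h2
  simp at h3
  exact List.cons_lt_cons_iff.2 (Or.inl h3)

lemma lt_hlt {u v : W} (h : u < v) (h1 : u ≠ []) (h2 : v ≠ []) (h3 : u.headD 0 ≠ v.headD 0) :
    hlt u v := by
  refine ⟨h1, h2, ?_⟩
  rcases u with _ | ⟨x, u⟩
  · simp at h1
  rcases v with _ | ⟨y, v⟩
  · simp at h2
  simp at h3
  rcases List.cons_lt_cons_iff.1 h with h | h
  · simpa using h
  · exact absurd h.1 h3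

lemma sort_of_hlt {l : List W} (h : l.Pairwise hlt) : l.toFinset.sort (· ≤ ·) = l := by
  have h' : l.Pairwise (· < ·) := h.imp hlt_lt
  apply (List.toFinset_sort (· ≤ ·) (h'.imp (fun h => ne_of_lt h))).2
  exact h'.imp le_of_lt

lemma wordOfSet_list {l : List W} (h : l.Pairwise hlt) : wordOfSet l.toFinset = wordOf l := by
  unfold wordOfSet wordOf
  rw [sort_of_hlt h]

lemma Good.sort_hlt {G : Finset W} (hG : Good G) : (G.sort (· ≤ ·)).Pairwise hlt := by
  have h : (G.sort (· ≤ ·)).Pairwise (· < ·) := (Finset.sortedLT_sort G).pairwise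
  apply h.imp_of_mem
  intro u v hu hv huv
  rw [Finset.mem_sort] at hu hv
  exact lt_hlt huv (hG.1 u hu).1 (hG.1 v hv).1 (fun hh => ne_of_lt huv (hG.2 u hu v hv hh))

lemma good_of_hlt {l : List W} (h : l.Pairwise hlt) (hd : ∀ w ∈ l, Dominated w) :
    Good l.toFinset := by
  refine ⟨by simpa using hd, ?_⟩
  simp only [List.mem_toFinset]
  intro u hu v hv huv
  by_contra hne
  have hsym : Std.Symm (fun u v : W => u.headD 0 ≠ v.headD 0) := ⟨fun _ _ h => h.symm⟩
  exact (h.imp (S := fun u v : W => u.headD 0 ≠ v.headD 0)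
    (fun h => ne_of_lt h.2.2)).forall hu hv hne huv

lemma segs_flatten {l : List W} (h : l.Pairwise (fun u v => hlt v u))
    (hd : ∀ w ∈ l, Dominated w) : segs l.flatten = l := by
  induction l with
  | nil => simp [segs]
  | cons w l ih =>
    rw [List.pairwise_cons] at h
    have hw := hd w (by simp)
    have ih' := ih h.2 (fun w hw => hd w (by simp [hw]))
    rcases w with _ | ⟨x, xs⟩
    · exact absurd rfl hw.1
    have hxs : ∀ y ∈ xs, decide (x ≤ y) = true := by
      intro y hy
      have := hw.2 y (by simp [hy])
      simpa using this
    have hflat : ∀ y t, l.flatten = y :: t → ¬ x ≤ y := by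
      intro y t hyt
      rcases l with _ | ⟨v, l⟩
      · simp at hyt
      · have := h.1 v (by simp)
        rcases v with _ | ⟨z, v⟩
        · exact absurd rfl this.1
        · have := this.2.2
          simp at hyt this
          omega
    rw [List.flatten_cons, List.cons_append, segs]
    have ht : (xs ++ l.flatten).takeWhile (fun y => decide (x ≤ y)) = xs := by
      rw [List.takeWhile_append_of_pos hxs]
      rcases hf : l.flatten with _ | ⟨y, t⟩
      · simp
      · simp [hflat y t hf]
    have hdr : (xs ++ l.flatten).dropWhile (fun y => decide (x ≤ y)) = l.flatten := by
      rw [List.dropWhile_append_of_pos hxs]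
      rcases hf : l.flatten with _ | ⟨y, t⟩
      · simp
      · simp [hflat y t hf]
    rw [ht, hdr, ih']

lemma LR_wordOfSet {G : Finset W} (hG : Good G) : LR (wordOfSet G) = G.sort (· ≤ ·) := by
  unfold LR wordOfSet
  rw [segs_flatten, List.reverse_reverse]
  · rw [List.pairwise_reverse]
    exact hG.sort_hlt
  · intro w hw
    exact hG.1 w (by simpa using hw)

lemma LRset_wordOfSet {G : Finset W} (hG : Good G) : (LR (wordOfSet G)).toFinset = G := by
  rw [LR_wordOfSet hG, Finset.sort_toFinset]

lemma flatten_segs (a : W) : (segs a).flatten = a := by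
  induction a using segs.induct with
  | case1 => simp [segs]
  | case2 x xs ih => rw [segs, List.flatten_cons, ih]; simp

lemma segs_hlt (a : W) : (segs a).Pairwise (fun u v => hlt v u) ∧ (∀ w ∈ segs a, Dominated w) := by
  induction a using segs.induct with
  | case1 => simp [segs]
  | case2 x xs ih =>
    obtain ⟨h1, h2⟩ := ih
    rw [segs]
    constructor
    · rw [List.pairwise_cons]
      refine ⟨?_, h1⟩
      rcases hs : segs (xs.dropWhile fun y => x ≤ y) with _ | ⟨v, l⟩
      · simp
      rw [hs] at h1 h2
      have hf := flatten_segs (xs.dropWhile fun y => x ≤ y)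
      rw [hs] at hf
      have hv := (h2 v (by simp)).1
      have key : v.headD 0 < x := by
        rcases v with _ | ⟨z, v⟩
        · exact absurd rfl hv
        have hne : xs.dropWhile (fun y => decide (x ≤ y)) ≠ [] := by
          rw [← hf]; simp
        have := List.head_dropWhile_not (fun y => decide (x ≤ y)) (l := xs) hne
        simp [← hf] at this
        simpa using this
      intro u hu
      rcases List.mem_cons.1 hu with rfl | hu
      · exact ⟨hv, by simp, by simpa using key⟩
      · have := (List.pairwise_cons.1 h1).1 u hu
        exact ⟨this.1, by simp, lt_trans this.2.2 key⟩
    · intro w hw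
      rcases List.mem_cons.1 hw with rfl | hw
      · refine ⟨by simp, ?_⟩
        intro y hy
        rcases List.mem_cons.1 hy with rfl | hy
        · simp
        · simpa using List.mem_takeWhile_imp hy
      · exact h2 w hw

lemma LR_hlt (a : W) : (LR a).Pairwise hlt := by
  unfold LR
  rw [List.pairwise_reverse]
  exact (segs_hlt a).1

lemma LR_good (a : W) : Good (LR a).toFinset :=
  good_of_hlt (LR_hlt a) (fun w hw => (segs_hlt a).2 w (by simpa [LR] using hw))

lemma Good.subset {G H : Finset W} (hG : Good G) (h : H ⊆ G) : Good H :=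
  ⟨fun w hw => hG.1 w (h hw), fun u hu v hv => hG.2 u (h hu) v (h hv)⟩

lemma wordOf_LR (a : W) : wordOf (LR a) = a := by
  simp [wordOf, LR, flatten_segs]

lemma subWord_eq {a : W} {S : Finset W} (h : S ⊆ (LR a).toFinset) :
    subWord a S = wordOfSet S := by
  unfold subWord
  rw [← wordOfSet_list ((LR_hlt a).filter _)]
  congr 1
  ext w
  have := @h w
  simp at this ⊢
  tauto

lemma subWord_sublist (a : W) (S : Finset W) : (subWord a S).Sublist a := by
  conv_rhs => rw [← wordOf_LR a]
  unfold subWord wordOf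
  apply List.Sublist.flatten
  apply List.Sublist.reverse
  exact List.filter_sublist

lemma mem_wordOfSet {G : Finset W} {x : ℕ} : x ∈ wordOfSet G ↔ ∃ w ∈ G, x ∈ w := by
  simp [wordOfSet]

lemma coe_wordOfSet (G : Finset W) : ((wordOfSet G : W) : Multiset ℕ) = ∑ w ∈ G, (w : Multiset ℕ) := by
  have h : ∀ l : List W, ((l.flatten : W) : Multiset ℕ) = (l.map (fun w : W => (w : Multiset ℕ))).sum := by
    intro l
    induction l with
    | nil => simp
    | cons w l ih => simp [← ih]
  unfold wordOfSet
  rw [h, List.map_reverse, List.sum_reverse]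
  rw [← List.sum_toFinset _ (Finset.sort_nodup _ _), Finset.sort_toFinset]

lemma headD_map {w : W} (f : ℕ → ℕ) (h : w ≠ []) : (w.map f).headD 0 = f (w.headD 0) := by
  rcases w with _ | ⟨x, w⟩
  · simp at h
  · simp

lemma headD_mem {w : W} (h : w ≠ []) : w.headD 0 ∈ w := by
  rcases w with _ | ⟨x, w⟩
  · simp at h
  · simp

lemma Dominated.map {w : W} {f : ℕ → ℕ} (h : Dominated w)
    (hf : ∀ x ∈ w, ∀ y ∈ w, x < y → f x < f y) : Dominated (w.map f) := by
  refine ⟨by simpa using h.1, ?_⟩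
  intro y hy
  obtain ⟨x, hx, rfl⟩ := List.mem_map.1 hy
  rw [headD_map f h.1]
  rcases (h.2 x hx).eq_or_lt with h' | h'
  · rw [h']
  · exact (hf _ (headD_mem h.1) _ hx h').le

lemma wordOfSet_map {G : Finset W} (hG : Good G) {f : ℕ → ℕ}
    (hf : ∀ x ∈ wordOfSet G, ∀ y ∈ wordOfSet G, x < y → f x < f y) :
    wordOfSet (G.image (List.map f)) = (wordOfSet G).map f ∧ Good (G.image (List.map f)) := by
  have e : G.image (List.map f) = ((G.sort (· ≤ ·)).map (List.map f)).toFinset := by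
    ext w; simp
  have hp : ((G.sort (· ≤ ·)).map (List.map f)).Pairwise hlt := by
    rw [List.pairwise_map]
    apply hG.sort_hlt.imp_of_mem
    intro u v hu hv huv
    rw [Finset.mem_sort] at hu hv
    refine ⟨by simpa using huv.1, by simpa using huv.2.1, ?_⟩
    rw [headD_map f huv.1, headD_map f huv.2.1]
    exact hf _ (mem_wordOfSet.2 ⟨u, hu, headD_mem huv.1⟩) _
      (mem_wordOfSet.2 ⟨v, hv, headD_mem huv.2.1⟩) huv.2.2
  rw [e]
  constructor
  · rw [wordOfSet_list hp]
    simp [wordOf, wordOfSet, List.map_flatten]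
  · apply good_of_hlt hp
    intro w hw
    obtain ⟨v, hv, rfl⟩ := List.mem_map.1 hw
    rw [Finset.mem_sort] at hv
    apply (hG.1 v hv).map
    intro x hx y hy
    exact hf x (mem_wordOfSet.2 ⟨v, hv, hx⟩) y (mem_wordOfSet.2 ⟨v, hv, hy⟩)

/-- matchings between two sets of words -/
noncomputable def Mat (X Y : Finset W) : Finset (Finset (W × W)) :=
  (X ×ˢ Y).powerset.filter
    (fun Θ => ∀ p ∈ Θ, ∀ q ∈ Θ, (p.1 = q.1 ∨ p.2 = q.2) → p = q)

/-- `X` consists of words with small letters, `Y` of words with large letters -/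
def SepW (m : ℕ) (X Y : Finset W) : Prop :=
  (∀ u ∈ X, u ≠ [] ∧ ∀ x ∈ u, x ≤ m) ∧ (∀ w ∈ Y, w ≠ [] ∧ ∀ x ∈ w, m < x)

def lo (m : ℕ) (s : W) : W := s.filter (fun x => x ≤ m)
def hi (m : ℕ) (s : W) : W := s.filter (fun x => m < x)

noncomputable def unA (m : ℕ) (S : Finset W) : Finset W := (S.image (lo m)).filter (· ≠ [])
noncomputable def unB (m : ℕ) (S : Finset W) : Finset W := (S.image (hi m)).filter (· ≠ [])
noncomputable def unT (m : ℕ) (S : Finset W) : Finset (W × W) :=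
  (S.image (fun s => (lo m s, hi m s))).filter (fun p => p.1 ≠ [] ∧ p.2 ≠ [])

lemma mem_Mat {X Y : Finset W} {Θ : Finset (W × W)} : Θ ∈ Mat X Y ↔
    (∀ u w, (u, w) ∈ Θ → u ∈ X ∧ w ∈ Y) ∧ (∀ u w w', (u, w) ∈ Θ → (u, w') ∈ Θ → w = w') ∧
    (∀ u u' w, (u, w) ∈ Θ → (u', w) ∈ Θ → u = u') := by
  unfold Mat
  rw [Finset.mem_filter, Finset.mem_powerset]
  constructor
  · rintro ⟨h1, h2⟩
    refine ⟨fun u w h => by simpa using h1 h, fun u w w' h h' => ?_, fun u u' w h h' => ?_⟩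
    · have := h2 _ h _ h' (Or.inl rfl)
      simpa using this
    · have := h2 _ h _ h' (Or.inr rfl)
      simpa using this
  · rintro ⟨h1, h2, h3⟩
    constructor
    · rintro ⟨u, w⟩ h
      simpa using h1 u w h
    · rintro ⟨u, w⟩ h ⟨u', w'⟩ h' (e | e)
      · simp at e; subst e; rw [h2 _ _ _ h h']
      · simp at e; subst e; rw [h3 _ _ _ h h']

lemma mem_glue {X Y : Finset W} {Θ : Finset (W × W)} {s : W} : s ∈ glueSet X Y Θ ↔
    (∃ u w, (u, w) ∈ Θ ∧ u ++ w = s) ∨ (s ∈ X ∧ ∀ w, (s, w) ∉ Θ) ∨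
    (s ∈ Y ∧ ∀ u, (u, s) ∉ Θ) := by
  unfold glueSet
  simp only [Finset.mem_union, Finset.mem_image, Finset.mem_filter, Prod.exists, or_assoc]
  apply or_congr Iff.rfl
  apply or_congr
  · apply and_congr Iff.rfl
    constructor
    · intro h w hw
      exact h _ hw rfl
    · rintro h ⟨u, w⟩ hp rfl
      exact h w hp
  · apply and_congr Iff.rfl
    constructor
    · intro h w hw
      exact h _ hw rfl
    · rintro h ⟨u, w⟩ hp rfl
      exact h u hp

lemma lo_small {m : ℕ} {u : W} (h : ∀ x ∈ u, x ≤ m) : lo m u = u ∧ hi m u = [] := by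
  unfold lo hi
  constructor
  · rw [List.filter_eq_self]; simpa using h
  · rw [List.filter_eq_nil_iff]; simpa using h

lemma hi_large {m : ℕ} {u : W} (h : ∀ x ∈ u, m < x) : lo m u = [] ∧ hi m u = u := by
  unfold lo hi
  constructor
  · rw [List.filter_eq_nil_iff]; simpa using h
  · rw [List.filter_eq_self]; simpa using h

lemma lohi_app {m : ℕ} {u w : W} (h : ∀ x ∈ u, x ≤ m) (h' : ∀ x ∈ w, m < x) :
    lo m (u ++ w) = u ∧ hi m (u ++ w) = w := by
  have h1 := lo_small h
  have h2 := hi_large h'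
  unfold lo hi at *
  simp only [List.filter_append]
  rw [h1.1, h1.2, h2.1, h2.2]
  simp

/-- normal form of the elements of a glued set -/
lemma mem_glue' {m : ℕ} {X Y : Finset W} {Θ : Finset (W × W)} {s : W} (hs : SepW m X Y)
    (hΘ : Θ ∈ Mat X Y) : s ∈ glueSet X Y Θ ↔ s = lo m s ++ hi m s ∧
    ((lo m s, hi m s) ∈ Θ ∨ (hi m s = [] ∧ lo m s ∈ X ∧ ∀ w, (lo m s, w) ∉ Θ) ∨
    (lo m s = [] ∧ hi m s ∈ Y ∧ ∀ u, (u, hi m s) ∉ Θ)) := by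
  rw [mem_glue]
  obtain ⟨h1, h2, h3⟩ := mem_Mat.1 hΘ
  constructor
  · rintro (⟨u, w, hp, rfl⟩ | ⟨hx, hn⟩ | ⟨hx, hn⟩)
    · have := lohi_app (hs.1 u (h1 u w hp).1).2 (hs.2 w (h1 u w hp).2).2
      rw [this.1, this.2]
      exact ⟨rfl, Or.inl hp⟩
    · have := lo_small (hs.1 s hx).2
      rw [this.1, this.2]
      exact ⟨by simp, Or.inr (Or.inl ⟨rfl, hx, hn⟩)⟩
    · have := hi_large (hs.2 s hx).2
      rw [this.1, this.2]
      exact ⟨by simp, Or.inr (Or.inr ⟨rfl, hx, hn⟩)⟩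
  · rintro ⟨he, (h | ⟨h, hx, hn⟩ | ⟨h, hx, hn⟩)⟩
    · exact Or.inl ⟨_, _, h, he.symm⟩
    · rw [h, List.append_nil] at he
      rw [← he] at hx hn
      exact Or.inr (Or.inl ⟨hx, hn⟩)
    · rw [h, List.nil_append] at he
      rw [← he] at hx hn
      exact Or.inr (Or.inr ⟨hx, hn⟩)

lemma mem_unA {m : ℕ} {S : Finset W} {u : W} : u ∈ unA m S ↔ u ≠ [] ∧ ∃ s ∈ S, lo m s = u := by
  simp [unA]; tauto
lemma mem_unB {m : ℕ} {S : Finset W} {u : W} : u ∈ unB m S ↔ u ≠ [] ∧ ∃ s ∈ S, hi m s = u := by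
  simp [unB]; tauto
lemma mem_unT {m : ℕ} {S : Finset W} {u w : W} : (u, w) ∈ unT m S ↔
    u ≠ [] ∧ w ≠ [] ∧ ∃ s ∈ S, lo m s = u ∧ hi m s = w := by
  simp [unT]; tauto

section
variable {m : ℕ} {X Y : Finset W} {Θ : Finset (W × W)}

lemma lo_mem (hs : SepW m X Y) (hΘ : Θ ∈ Mat X Y) {s : W} (h : s ∈ glueSet X Y Θ)
    (hn : lo m s ≠ []) : lo m s ∈ X := by
  have := (mem_glue' hs hΘ).1 h
  have h1 := (mem_Mat.1 hΘ).1
  grind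

lemma hi_mem (hs : SepW m X Y) (hΘ : Θ ∈ Mat X Y) {s : W} (h : s ∈ glueSet X Y Θ)
    (hn : hi m s ≠ []) : hi m s ∈ Y := by
  have := (mem_glue' hs hΘ).1 h
  have h1 := (mem_Mat.1 hΘ).1
  grind

lemma lohi_mem (hs : SepW m X Y) (hΘ : Θ ∈ Mat X Y) {s : W} (h : s ∈ glueSet X Y Θ)
    (hn : lo m s ≠ []) (hn' : hi m s ≠ []) : (lo m s, hi m s) ∈ Θ := by
  have := (mem_glue' hs hΘ).1 h
  grind

lemma lo_inj (hs : SepW m X Y) (hΘ : Θ ∈ Mat X Y) {s t : W} (h : s ∈ glueSet X Y Θ)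
    (h' : t ∈ glueSet X Y Θ) (hn : lo m s ≠ []) (e : lo m s = lo m t) : s = t := by
  have e1 := (mem_glue' hs hΘ).1 h
  have e2 := (mem_glue' hs hΘ).1 h'
  obtain ⟨h1, h2, h3⟩ := mem_Mat.1 hΘ
  have : hi m s = hi m t := by
    rcases e1.2 with a | a | a <;> rcases e2.2 with b | b | b <;> grind
  rw [e1.1, e2.1, e, this]

lemma hi_inj (hs : SepW m X Y) (hΘ : Θ ∈ Mat X Y) {s t : W} (h : s ∈ glueSet X Y Θ)
    (h' : t ∈ glueSet X Y Θ) (hn : hi m s ≠ []) (e : hi m s = hi m t) : s = t := by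
  have e1 := (mem_glue' hs hΘ).1 h
  have e2 := (mem_glue' hs hΘ).1 h'
  obtain ⟨h1, h2, h3⟩ := mem_Mat.1 hΘ
  have : lo m s = lo m t := by
    rcases e1.2 with a | a | a <;> rcases e2.2 with b | b | b <;> grind
  rw [e1.1, e2.1, e, this]

lemma lohi_ne (hs : SepW m X Y) (hΘ : Θ ∈ Mat X Y) {s : W} (h : s ∈ glueSet X Y Θ) :
    lo m s ≠ [] ∨ hi m s ≠ [] := by
  have e1 := (mem_glue' hs hΘ).1 h
  obtain ⟨h1, h2, h3⟩ := mem_Mat.1 hΘ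
  have := hs.1 []
  have := hs.2 []
  grind

lemma exists_lo (hs : SepW m X Y) (hΘ : Θ ∈ Mat X Y) {u : W} (h : u ∈ X) :
    ∃ s ∈ glueSet X Y Θ, lo m s = u := by
  by_cases hw : ∃ w, (u, w) ∈ Θ
  · obtain ⟨w, hw⟩ := hw
    exact ⟨u ++ w, mem_glue.2 (Or.inl ⟨u, w, hw, rfl⟩),
      (lohi_app (hs.1 u h).2 (hs.2 w ((mem_Mat.1 hΘ).1 u w hw).2).2).1⟩
  · push Not at hw
    exact ⟨u, mem_glue.2 (Or.inr (Or.inl ⟨h, hw⟩)), (lo_small (hs.1 u h).2).1⟩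

lemma exists_hi (hs : SepW m X Y) (hΘ : Θ ∈ Mat X Y) {w : W} (h : w ∈ Y) :
    ∃ s ∈ glueSet X Y Θ, hi m s = w := by
  by_cases hw : ∃ u, (u, w) ∈ Θ
  · obtain ⟨u, hw⟩ := hw
    exact ⟨u ++ w, mem_glue.2 (Or.inl ⟨u, w, hw, rfl⟩),
      (lohi_app (hs.1 u ((mem_Mat.1 hΘ).1 u w hw).1).2 (hs.2 w h).2).2⟩
  · push Not at hw
    exact ⟨w, mem_glue.2 (Or.inr (Or.inr ⟨h, hw⟩)), (hi_large (hs.2 w h).2).2⟩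

lemma exists_lohi (hs : SepW m X Y) (hΘ : Θ ∈ Mat X Y) {u w : W} (h : (u, w) ∈ Θ) :
    ∃ s ∈ glueSet X Y Θ, lo m s = u ∧ hi m s = w := by
  have := (mem_Mat.1 hΘ).1 u w h
  exact ⟨u ++ w, mem_glue.2 (Or.inl ⟨u, w, h, rfl⟩),
      (lohi_app (hs.1 u this.1).2 (hs.2 w this.2).2)⟩

lemma SepW.ne (hs : SepW m X Y) : (∀ u ∈ X, u ≠ []) ∧ (∀ w ∈ Y, w ≠ []) :=
  ⟨fun u h => (hs.1 u h).1, fun u h => (hs.2 u h).1⟩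

lemma unA_glue (hs : SepW m X Y) (hΘ : Θ ∈ Mat X Y) : unA m (glueSet X Y Θ) = X := by
  ext u
  rw [mem_unA]
  constructor
  · rintro ⟨h, s, hs', rfl⟩
    exact lo_mem hs hΘ hs' h
  · intro h
    exact ⟨hs.ne.1 u h, exists_lo hs hΘ h⟩

lemma unB_glue (hs : SepW m X Y) (hΘ : Θ ∈ Mat X Y) : unB m (glueSet X Y Θ) = Y := by
  ext u
  rw [mem_unB]
  constructor
  · rintro ⟨h, s, hs', rfl⟩
    exact hi_mem hs hΘ hs' h
  · intro h
    exact ⟨hs.ne.2 u h, exists_hi hs hΘ h⟩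

lemma unT_glue (hs : SepW m X Y) (hΘ : Θ ∈ Mat X Y) : unT m (glueSet X Y Θ) = Θ := by
  ext ⟨u, w⟩
  rw [mem_unT]
  constructor
  · rintro ⟨h, h', s, hs', rfl, rfl⟩
    exact lohi_mem hs hΘ hs' h h'
  · intro h
    have := (mem_Mat.1 hΘ).1 u w h
    exact ⟨hs.ne.1 u this.1, hs.ne.2 w this.2, exists_lohi hs hΘ h⟩

lemma un_sep (hs : SepW m X Y) (hΘ : Θ ∈ Mat X Y) {S : Finset W} (hS : S ⊆ glueSet X Y Θ) :
    unA m S ⊆ X ∧ unB m S ⊆ Y := by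
  constructor
  · intro u hu
    obtain ⟨h, s, hs', rfl⟩ := mem_unA.1 hu
    exact lo_mem hs hΘ (hS hs') h
  · intro u hu
    obtain ⟨h, s, hs', rfl⟩ := mem_unB.1 hu
    exact hi_mem hs hΘ (hS hs') h

lemma SepW.mono (hs : SepW m X Y) {A B : Finset W} (hA : A ⊆ X) (hB : B ⊆ Y) : SepW m A B :=
  ⟨fun u h => hs.1 u (hA h), fun u h => hs.2 u (hB h)⟩

lemma unT_mat (hs : SepW m X Y) (hΘ : Θ ∈ Mat X Y) {S : Finset W} (hS : S ⊆ glueSet X Y Θ) :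
    unT m S ∈ Mat (unA m S) (unB m S) := by
  rw [mem_Mat]
  refine ⟨?_, ?_, ?_⟩
  · intro u w h
    obtain ⟨h1, h2, s, h3, h4, h5⟩ := mem_unT.1 h
    exact ⟨mem_unA.2 ⟨h1, s, h3, h4⟩, mem_unB.2 ⟨h2, s, h3, h5⟩⟩
  · intro u w w' h h'
    obtain ⟨h1, h2, s, h3, h4, h5⟩ := mem_unT.1 h
    obtain ⟨h1', h2', s', h3', h4', h5'⟩ := mem_unT.1 h'
    have := lo_inj hs hΘ (hS h3) (hS h3') (by rw [h4]; exact h1) (h4.trans h4'.symm)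
    rw [← h5, ← h5', this]
  · intro u w w' h h'
    obtain ⟨h1, h2, s, h3, h4, h5⟩ := mem_unT.1 h
    obtain ⟨h1', h2', s', h3', h4', h5'⟩ := mem_unT.1 h'
    have := hi_inj hs hΘ (hS h3) (hS h3') (by rw [h5]; exact h2) (h5.trans h5'.symm)
    rw [← h4, ← h4', this]

lemma glue_un (hs : SepW m X Y) (hΘ : Θ ∈ Mat X Y) {S : Finset W} (hS : S ⊆ glueSet X Y Θ) :
    glueSet (unA m S) (unB m S) (unT m S) = S := by
  have hu := un_sep hs hΘ hS
  have hs' := hs.mono hu.1 hu.2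
  have hΘ' := unT_mat hs hΘ hS
  ext s
  constructor
  · intro h
    have he := ((mem_glue' hs' hΘ').1 h).1
    rcases lohi_ne hs' hΘ' h with hn | hn
    · obtain ⟨_, t, ht, e⟩ := mem_unA.1 (lo_mem hs' hΘ' h hn)
      by_cases hh : hi m t = []
      · have : hi m s = [] := by
          by_contra hc
          have h4 := lohi_mem hs' hΘ' h hn hc
          obtain ⟨_, _, t', ht', e', e''⟩ := mem_unT.1 h4
          have := lo_inj hs hΘ (hS ht') (hS ht) (by rw [e']; exact hn) (e'.trans e.symm)
          subst this
          exact hc (e''.symm.trans hh)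
        have e3 := ((mem_glue' hs hΘ).1 (hS ht)).1
        rw [he, this, ← e, ← hh, ← e3]; exact ht
      · have h4 : (lo m s, hi m t) ∈ unT m S := mem_unT.2 ⟨hn, hh, t, ht, e, rfl⟩
        have h5 : hi m s = hi m t := by
          have h6 := ((mem_glue' hs' hΘ').1 h).2
          rcases h6 with h6 | h6 | h6
          · exact (mem_Mat.1 hΘ').2.1 _ _ _ h6 h4
          · exact absurd h4 (h6.2.2 _)
          · exact absurd h6.1 hn
        have e3 := ((mem_glue' hs hΘ).1 (hS ht)).1
        rw [he, h5, ← e, ← e3]; exact ht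
    · obtain ⟨_, t, ht, e⟩ := mem_unB.1 (hi_mem hs' hΘ' h hn)
      by_cases hh : lo m t = []
      · have : lo m s = [] := by
          by_contra hc
          have h4 := lohi_mem hs' hΘ' h hc hn
          obtain ⟨_, _, t', ht', e', e''⟩ := mem_unT.1 h4
          have := hi_inj hs hΘ (hS ht') (hS ht) (by rw [e'']; exact hn) (e''.trans e.symm)
          subst this
          exact hc (e'.symm.trans hh)
        have e3 := ((mem_glue' hs hΘ).1 (hS ht)).1
        rw [he, this, ← e, ← hh, ← e3]; exact ht
      · have h4 : (lo m t, hi m s) ∈ unT m S := mem_unT.2 ⟨hh, hn, t, ht, rfl, e⟩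
        have h5 : lo m s = lo m t := by
          have h6 := ((mem_glue' hs' hΘ').1 h).2
          rcases h6 with h6 | h6 | h6
          · exact (mem_Mat.1 hΘ').2.2 _ _ _ h6 h4
          · exact absurd h6.1 hn
          · exact absurd h4 (h6.2.2 _)
        have e3 := ((mem_glue' hs hΘ).1 (hS ht)).1
        rw [he, h5, ← e, ← e3]; exact ht
  · intro h
    rw [mem_glue' hs' hΘ']
    have h1 := (mem_glue' hs hΘ).1 (hS h)
    refine ⟨h1.1, ?_⟩
    by_cases ha : lo m s = []
    · have hb : hi m s ≠ [] := by
        rcases lohi_ne hs hΘ (hS h) with h2 | h2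
        · exact absurd ha h2
        · exact h2
      refine Or.inr (Or.inr ⟨ha, mem_unB.2 ⟨hb, s, h, rfl⟩, ?_⟩)
      intro u hu
      obtain ⟨h3, _, t, ht, e, e'⟩ := mem_unT.1 hu
      have := hi_inj hs hΘ (hS h) (hS ht) hb e'.symm
      subst this
      exact h3 (e.symm.trans ha)
    · by_cases hb : hi m s = []
      · refine Or.inr (Or.inl ⟨hb, mem_unA.2 ⟨ha, s, h, rfl⟩, ?_⟩)
        intro u hu
        obtain ⟨_, h3, t, ht, e, e'⟩ := mem_unT.1 hu
        have := lo_inj hs hΘ (hS h) (hS ht) ha e.symm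
        subst this
        exact h3 (e'.symm.trans hb)
      · exact Or.inl (mem_unT.2 ⟨ha, hb, s, h, rfl, rfl⟩)

lemma sdiff_unA (hs : SepW m X Y) (hΘ : Θ ∈ Mat X Y) {S : Finset W} (hS : S ⊆ glueSet X Y Θ) :
    X \ unA m S = unA m (glueSet X Y Θ \ S) := by
  ext u
  rw [Finset.mem_sdiff]
  constructor
  · rintro ⟨h, hn⟩
    obtain ⟨s, h1, h2⟩ := exists_lo hs hΘ h
    refine mem_unA.2 ⟨hs.ne.1 u h, s, ?_, h2⟩
    rw [Finset.mem_sdiff]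
    exact ⟨h1, fun hc => hn (mem_unA.2 ⟨hs.ne.1 u h, s, hc, h2⟩)⟩
  · intro h
    refine ⟨(un_sep hs hΘ Finset.sdiff_subset).1 h, ?_⟩
    intro hc
    obtain ⟨h1, s, h2, h3⟩ := mem_unA.1 h
    obtain ⟨_, t, h4, h5⟩ := mem_unA.1 hc
    rw [Finset.mem_sdiff] at h2
    have := lo_inj hs hΘ h2.1 (hS h4) (by rw [h3]; exact h1) (h3.trans h5.symm)
    subst this
    exact h2.2 h4

lemma sdiff_unB (hs : SepW m X Y) (hΘ : Θ ∈ Mat X Y) {S : Finset W} (hS : S ⊆ glueSet X Y Θ) :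
    Y \ unB m S = unB m (glueSet X Y Θ \ S) := by
  ext u
  rw [Finset.mem_sdiff]
  constructor
  · rintro ⟨h, hn⟩
    obtain ⟨s, h1, h2⟩ := exists_hi hs hΘ h
    refine mem_unB.2 ⟨hs.ne.2 u h, s, ?_, h2⟩
    rw [Finset.mem_sdiff]
    exact ⟨h1, fun hc => hn (mem_unB.2 ⟨hs.ne.2 u h, s, hc, h2⟩)⟩
  · intro h
    refine ⟨(un_sep hs hΘ Finset.sdiff_subset).2 h, ?_⟩
    intro hc
    obtain ⟨h1, s, h2, h3⟩ := mem_unB.1 h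
    obtain ⟨_, t, h4, h5⟩ := mem_unB.1 hc
    rw [Finset.mem_sdiff] at h2
    have := hi_inj hs hΘ h2.1 (hS h4) (by rw [h3]; exact h1) (h3.trans h5.symm)
    subst this
    exact h2.2 h4

lemma unT_union (S T : Finset W) : unT m S ∪ unT m T = unT m (S ∪ T) := by
  unfold unT
  rw [Finset.image_union, Finset.filter_union]

lemma mat_union {A B : Finset W} (hA : A ⊆ X) (hB : B ⊆ Y) {Θ₁ Θ₂ : Finset (W × W)}
    (h₁ : Θ₁ ∈ Mat A B) (h₂ : Θ₂ ∈ Mat (X \ A) (Y \ B)) : Θ₁ ∪ Θ₂ ∈ Mat X Y := by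
  rw [mem_Mat] at *
  simp only [Finset.mem_union, Finset.mem_sdiff] at *
  obtain ⟨a1, a2, a3⟩ := h₁
  obtain ⟨b1, b2, b3⟩ := h₂
  refine ⟨?_, ?_, ?_⟩
  · rintro u w (h | h)
    · exact ⟨hA (a1 u w h).1, hB (a1 u w h).2⟩
    · exact ⟨(b1 u w h).1.1, (b1 u w h).2.1⟩
  · rintro u w w' (h | h) (h' | h')
    · exact a2 _ _ _ h h'
    · exact absurd (a1 _ _ h).1 (b1 _ _ h').1.2
    · exact absurd (a1 _ _ h').1 (b1 _ _ h).1.2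
    · exact b2 _ _ _ h h'
  · rintro u w w' (h | h) (h' | h')
    · exact a3 _ _ _ h h'
    · exact absurd (a1 _ _ h).2 (b1 _ _ h').2.2
    · exact absurd (a1 _ _ h').2 (b1 _ _ h).2.2
    · exact b3 _ _ _ h h'

lemma glue_union {A B : Finset W} (hA : A ⊆ X) (hB : B ⊆ Y) {Θ₁ Θ₂ : Finset (W × W)}
    (h₁ : Θ₁ ∈ Mat A B) (h₂ : Θ₂ ∈ Mat (X \ A) (Y \ B)) :
    glueSet X Y (Θ₁ ∪ Θ₂) = glueSet A B Θ₁ ∪ glueSet (X \ A) (Y \ B) Θ₂ := by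
  ext s
  rw [Finset.mem_union]
  simp only [mem_glue, Finset.mem_union, Finset.mem_sdiff]
  rw [mem_Mat] at *
  simp only [Finset.mem_sdiff] at *
  obtain ⟨a1, a2, a3⟩ := h₁
  obtain ⟨b1, b2, b3⟩ := h₂
  have hA' := @hA s
  have hB' := @hB s
  constructor
  · rintro (⟨u, w, (h | h), rfl⟩ | ⟨h, hn⟩ | ⟨h, hn⟩)
    · exact Or.inl (Or.inl ⟨u, w, h, rfl⟩)
    · exact Or.inr (Or.inl ⟨u, w, h, rfl⟩)
    · push Not at hn
      by_cases hc : s ∈ A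
      · exact Or.inl (Or.inr (Or.inl ⟨hc, fun w => (hn w).1⟩))
      · exact Or.inr (Or.inr (Or.inl ⟨⟨h, hc⟩, fun w => (hn w).2⟩))
    · push Not at hn
      by_cases hc : s ∈ B
      · exact Or.inl (Or.inr (Or.inr ⟨hc, fun w => (hn w).1⟩))
      · exact Or.inr (Or.inr (Or.inr ⟨⟨h, hc⟩, fun w => (hn w).2⟩))
  · rintro ((⟨u, w, h, rfl⟩ | ⟨h, hn⟩ | ⟨h, hn⟩) | (⟨u, w, h, rfl⟩ | ⟨h, hn⟩ | ⟨h, hn⟩))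
    · exact Or.inl ⟨u, w, Or.inl h, rfl⟩
    · exact Or.inr (Or.inl ⟨hA' h, by
        rintro w (h' | h')
        · exact hn w h'
        · exact (b1 _ _ h').1.2 h⟩)
    · exact Or.inr (Or.inr ⟨hB' h, by
        rintro w (h' | h')
        · exact hn w h'
        · exact (b1 _ _ h').2.2 h⟩)
    · exact Or.inl ⟨u, w, Or.inr h, rfl⟩
    · exact Or.inr (Or.inl ⟨h.1, by
        rintro w (h' | h')
        · exact h.2 (a1 _ _ h').1
        · exact hn w h'⟩)
    · exact Or.inr (Or.inr ⟨h.1, by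
        rintro w (h' | h')
        · exact h.2 (a1 _ _ h').2
        · exact hn w h'⟩)

lemma glue_disj (hs : SepW m X Y) {A B : Finset W} (hA : A ⊆ X) (hB : B ⊆ Y)
    {Θ₁ Θ₂ : Finset (W × W)}
    (h₁ : Θ₁ ∈ Mat A B) (h₂ : Θ₂ ∈ Mat (X \ A) (Y \ B)) :
    Disjoint (glueSet A B Θ₁) (glueSet (X \ A) (Y \ B) Θ₂) := by
  rw [Finset.disjoint_left]
  intro s h h'
  have s1 := hs.mono hA hB
  have s2 : SepW m (X \ A) (Y \ B) := hs.mono Finset.sdiff_subset Finset.sdiff_subset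
  rcases lohi_ne s1 h₁ h with hn | hn
  · have e1 := lo_mem s1 h₁ h hn
    have e2 := lo_mem s2 h₂ h' hn
    exact (Finset.mem_sdiff.1 e2).2 e1
  · have e1 := hi_mem s1 h₁ h hn
    have e2 := hi_mem s2 h₂ h' hn
    exact (Finset.mem_sdiff.1 e2).2 e1

lemma main_bij {N : Type} [AddCommMonoid N] (hs : SepW m X Y) (g : Finset W → Finset W → N) :
    ∑ Θ ∈ Mat X Y, ∑ S ∈ (glueSet X Y Θ).powerset, g S (glueSet X Y Θ \ S) =
    ∑ A ∈ X.powerset, ∑ B ∈ Y.powerset, ∑ Θ₁ ∈ Mat A B, ∑ Θ₂ ∈ Mat (X \ A) (Y \ B),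
      g (glueSet A B Θ₁) (glueSet (X \ A) (Y \ B) Θ₂) := by
  simp only [Finset.sum_sigma']
  refine Finset.sum_bij'
    (fun p _ => ⟨unA m p.2, unB m p.2, unT m p.2, unT m (glueSet X Y p.1 \ p.2)⟩)
    (fun q _ => ⟨q.2.2.1 ∪ q.2.2.2, glueSet q.1 q.2.1 q.2.2.1⟩) ?_ ?_ ?_ ?_ ?_
  · rintro ⟨Θ, S⟩ hp
    simp only [Finset.mem_sigma, Finset.mem_powerset] at hp ⊢
    obtain ⟨hΘ, hS⟩ := hp
    refine ⟨(un_sep hs hΘ hS).1, (un_sep hs hΘ hS).2, unT_mat hs hΘ hS, ?_⟩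
    rw [sdiff_unA hs hΘ hS, sdiff_unB hs hΘ hS]
    exact unT_mat hs hΘ Finset.sdiff_subset
  · rintro ⟨A, B, Θ₁, Θ₂⟩ hq
    simp only [Finset.mem_sigma, Finset.mem_powerset] at hq ⊢
    obtain ⟨hA, hB, h1, h2⟩ := hq
    refine ⟨mat_union hA hB h1 h2, ?_⟩
    rw [glue_union hA hB h1 h2]
    exact Finset.subset_union_left
  · rintro ⟨Θ, S⟩ hp
    simp only [Finset.mem_sigma, Finset.mem_powerset] at hp ⊢
    obtain ⟨hΘ, hS⟩ := hp
    rw [glue_un hs hΘ hS, unT_union, Finset.union_sdiff_of_subset hS, unT_glue hs hΘ]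
  · rintro ⟨A, B, Θ₁, Θ₂⟩ hq
    simp only [Finset.mem_sigma, Finset.mem_powerset] at hq ⊢
    obtain ⟨hA, hB, h1, h2⟩ := hq
    have s1 := hs.mono hA hB
    have s2 : SepW m (X \ A) (Y \ B) := hs.mono Finset.sdiff_subset Finset.sdiff_subset
    rw [unA_glue s1 h1, unB_glue s1 h1, unT_glue s1 h1, glue_union hA hB h1 h2,
      Finset.union_sdiff_cancel_left (glue_disj hs hA hB h1 h2), unT_glue s2 h2]
  · rintro ⟨Θ, S⟩ hp
    simp only [Finset.mem_sigma, Finset.mem_powerset] at hp ⊢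
    obtain ⟨hΘ, hS⟩ := hp
    rw [sdiff_unA hs hΘ hS, sdiff_unB hs hΘ hS, glue_un hs hΘ hS,
      glue_un hs hΘ Finset.sdiff_subset]
end

section
variable {m : ℕ} {X Y : Finset W} {Θ : Finset (W × W)}

lemma sum_glue (hs : SepW m X Y) (hΘ : Θ ∈ Mat X Y) :
    ∑ s ∈ glueSet X Y Θ, (s : Multiset ℕ) =
      ∑ u ∈ X, (u : Multiset ℕ) + ∑ w ∈ Y, (w : Multiset ℕ) := by
  have e1 : ∑ s ∈ glueSet X Y Θ, (s : Multiset ℕ) =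
      ∑ s ∈ glueSet X Y Θ, ((lo m s : W) : Multiset ℕ) +
      ∑ s ∈ glueSet X Y Θ, ((hi m s : W) : Multiset ℕ) := by
    rw [← Finset.sum_add_distrib]
    apply Finset.sum_congr rfl
    intro s h
    conv_lhs => rw [((mem_glue' hs hΘ).1 h).1]
    rfl
  have e2 : ∑ s ∈ glueSet X Y Θ, ((lo m s : W) : Multiset ℕ) = ∑ u ∈ X, (u : Multiset ℕ) := by
    have hX : X = ((glueSet X Y Θ).filter (fun s => lo m s ≠ [])).image (lo m) := by
      conv_lhs => rw [← unA_glue hs hΘ]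
      ext u
      rw [mem_unA]
      simp only [Finset.mem_image, Finset.mem_filter]
      grind
    conv_rhs => rw [hX]
    rw [Finset.sum_image]
    · rw [Finset.sum_filter_of_ne]
      intro s _ h hc
      exact h (by simp [hc])
    · intro s h t h' e
      simp only [Finset.coe_filter, Set.mem_ofPred_eq] at h h'
      exact lo_inj hs hΘ h.1 h'.1 h.2 e
  have e3 : ∑ s ∈ glueSet X Y Θ, ((hi m s : W) : Multiset ℕ) = ∑ u ∈ Y, (u : Multiset ℕ) := by
    have hX : Y = ((glueSet X Y Θ).filter (fun s => hi m s ≠ [])).image (hi m) := by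
      conv_lhs => rw [← unB_glue hs hΘ]
      ext u
      rw [mem_unB]
      simp only [Finset.mem_image, Finset.mem_filter]
      grind
    conv_rhs => rw [hX]
    rw [Finset.sum_image]
    · rw [Finset.sum_filter_of_ne]
      intro s _ h hc
      exact h (by simp [hc])
    · intro s h t h' e
      simp only [Finset.coe_filter, Set.mem_ofPred_eq] at h h'
      exact hi_inj hs hΘ h.1 h'.1 h.2 e
  rw [e1, e2, e3]

lemma headD_app {u w : W} (h : u ≠ []) : (u ++ w).headD 0 = u.headD 0 := by
  rcases u with _ | ⟨x, u⟩
  · exact absurd rfl h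
  · rfl

lemma good_glue (hs : SepW m X Y) (hΘ : Θ ∈ Mat X Y) (hX : Good X) (hY : Good Y) :
    Good (glueSet X Y Θ) := by
  have head1 : ∀ s ∈ glueSet X Y Θ, lo m s ≠ [] → s.headD 0 = (lo m s).headD 0 := by
    intro s h hn
    conv_lhs => rw [((mem_glue' hs hΘ).1 h).1]
    exact headD_app hn
  have head2 : ∀ s ∈ glueSet X Y Θ, lo m s = [] → s = hi m s := by
    intro s h hn
    conv_lhs => rw [((mem_glue' hs hΘ).1 h).1, hn]
    rfl
  have h2n : ∀ s ∈ glueSet X Y Θ, lo m s = [] → hi m s ≠ [] := by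
    intro s h hn
    rcases lohi_ne hs hΘ h with h' | h'
    · exact absurd hn h'
    · exact h'
  constructor
  · intro s h
    by_cases hn : lo m s = []
    · rw [head2 s h hn]
      exact hY.1 _ (hi_mem hs hΘ h (h2n s h hn))
    · have hm := lo_mem hs hΘ h hn
      have hd := hX.1 _ hm
      refine ⟨fun hc => hn (by rw [hc]; rfl), ?_⟩
      intro x hx
      rw [head1 s h hn]
      by_cases hxm : x ≤ m
      · exact hd.2 x (by simp [lo, hx, hxm])
      · have := (hs.1 _ hm).2 _ (headD_mem hn)
        omega
  · intro s h t h' e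
    by_cases hn : lo m s = []
    · have e1 := head2 s h hn
      have m1 := hi_mem hs hΘ h (h2n s h hn)
      by_cases hn' : lo m t = []
      · have e2 := head2 t h' hn'
        have m2 := hi_mem hs hΘ h' (h2n t h' hn')
        rw [← e1] at m1
        rw [← e2] at m2
        exact hY.2 s m1 t m2 e
      · have m2 := lo_mem hs hΘ h' hn'
        have := (hs.1 _ m2).2 _ (headD_mem hn')
        rw [← head1 t h' hn', ← e] at this
        rw [← e1] at m1
        have := (hs.2 s m1).2 _ (headD_mem (hs.2 s m1).1)
        omega
    · have m1 := lo_mem hs hΘ h hn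
      by_cases hn' : lo m t = []
      · have e2 := head2 t h' hn'
        have m2 := hi_mem hs hΘ h' (h2n t h' hn')
        have := (hs.1 _ m1).2 _ (headD_mem hn)
        rw [← head1 s h hn, e] at this
        rw [← e2] at m2
        have := (hs.2 t m2).2 _ (headD_mem (hs.2 t m2).1)
        omega
      · have m2 := lo_mem hs hΘ h' hn'
        rw [head1 s h hn, head1 t h' hn'] at e
        exact lo_inj hs hΘ h h' hn (hX.2 _ m1 _ m2 e)

lemma mem_image_pair {φ : W → W} {u w : W} :
    (u, w) ∈ Θ.image (Prod.map φ φ) ↔ ∃ x y, (x, y) ∈ Θ ∧ φ x = u ∧ φ y = w := by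
  simp [Prod.map]

lemma glue_image {φ : W → W} (happ : ∀ u w, φ (u ++ w) = φ u ++ φ w)
    (hX : ∀ u ∈ X, ∀ v ∈ X, φ u = φ v → u = v) (hY : ∀ u ∈ Y, ∀ v ∈ Y, φ u = φ v → u = v)
    (hΘ : Θ ∈ Mat X Y) :
    glueSet (X.image φ) (Y.image φ) (Θ.image (Prod.map φ φ)) = (glueSet X Y Θ).image φ := by
  obtain ⟨h1, h2, h3⟩ := mem_Mat.1 hΘ
  ext s
  rw [Finset.mem_image]
  simp only [mem_glue, mem_image_pair]
  simp only [Finset.mem_image]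
  constructor
  · rintro (⟨u, w, ⟨x, y, h, rfl, rfl⟩, rfl⟩ | ⟨⟨u, hu, rfl⟩, hn⟩ | ⟨⟨u, hu, rfl⟩, hn⟩)
    · exact ⟨x ++ y, Or.inl ⟨x, y, h, rfl⟩, happ x y⟩
    · exact ⟨u, Or.inr (Or.inl ⟨hu, fun w hw => hn (φ w) ⟨u, w, hw, rfl, rfl⟩⟩), rfl⟩
    · exact ⟨u, Or.inr (Or.inr ⟨hu, fun w hw => hn (φ w) ⟨w, u, hw, rfl, rfl⟩⟩), rfl⟩
  · rintro ⟨t, (⟨u, w, h, rfl⟩ | ⟨hu, hn⟩ | ⟨hu, hn⟩), rfl⟩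
    · exact Or.inl ⟨φ u, φ w, ⟨u, w, h, rfl, rfl⟩, (happ u w).symm⟩
    · refine Or.inr (Or.inl ⟨⟨t, hu, rfl⟩, ?_⟩)
      rintro w ⟨x, y, h, e, rfl⟩
      have := hX x (h1 x y h).1 t hu e
      subst this
      exact hn y h
    · refine Or.inr (Or.inr ⟨⟨t, hu, rfl⟩, ?_⟩)
      rintro w ⟨x, y, h, rfl, e⟩
      have := hY y (h1 x y h).2 t hu e
      subst this
      exact hn x h

lemma sum_Mat_image {N : Type} [AddCommMonoid N] {φ : W → W}
    (hX : ∀ u ∈ X, ∀ v ∈ X, φ u = φ v → u = v) (hY : ∀ u ∈ Y, ∀ v ∈ Y, φ u = φ v → u = v)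
    (F : Finset (W × W) → N) :
    ∑ Θ ∈ Mat (X.image φ) (Y.image φ), F Θ =
      ∑ Θ ∈ Mat X Y, F (Θ.image (Prod.map φ φ)) := by
  symm
  refine Finset.sum_bij' (fun Θ _ => Θ.image (Prod.map φ φ))
    (fun Θ' _ => (X ×ˢ Y).filter (fun p => Prod.map φ φ p ∈ Θ')) ?_ ?_ ?_ ?_ ?_
  · intro Θ hΘ
    obtain ⟨h1, h2, h3⟩ := mem_Mat.1 hΘ
    rw [mem_Mat]
    simp only [mem_image_pair]
    refine ⟨?_, ?_, ?_⟩
    · rintro u w ⟨x, y, h, rfl, rfl⟩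
      exact ⟨Finset.mem_image_of_mem _ (h1 x y h).1, Finset.mem_image_of_mem _ (h1 x y h).2⟩
    · rintro u w w' ⟨x, y, h, rfl, rfl⟩ ⟨x', y', h', e, rfl⟩
      have := hX _ (h1 _ _ h').1 _ (h1 _ _ h).1 e
      subst this
      rw [h2 _ _ _ h h']
    · rintro u w w' ⟨x, y, h, rfl, rfl⟩ ⟨x', y', h', rfl, e⟩
      have := hY _ (h1 _ _ h').2 _ (h1 _ _ h).2 e
      subst this
      rw [h3 _ _ _ h h']
  · intro Θ' hΘ
    obtain ⟨h1, h2, h3⟩ := mem_Mat.1 hΘ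
    rw [mem_Mat]
    simp only [Finset.mem_filter, Finset.mem_product, Prod.map]
    refine ⟨?_, ?_, ?_⟩
    · rintro u w h
      exact h.1
    · rintro u w w' h h'
      exact hY _ h.1.2 _ h'.1.2 (h2 _ _ _ h.2 h'.2)
    · rintro u w w' h h'
      exact hX _ h.1.1 _ h'.1.1 (h3 _ _ _ h.2 h'.2)
  · intro Θ hΘ
    obtain ⟨h1, h2, h3⟩ := mem_Mat.1 hΘ
    ext ⟨u, w⟩
    simp only [Finset.mem_filter, Finset.mem_product, Prod.map]
    rw [mem_image_pair]
    constructor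
    · rintro ⟨hm, x, y, h, e, e'⟩
      have := hX _ (h1 _ _ h).1 _ hm.1 e
      have := hY _ (h1 _ _ h).2 _ hm.2 e'
      subst_vars
      exact h
    · intro h
      exact ⟨h1 u w h, u, w, h, rfl, rfl⟩
  · intro Θ' hΘ
    obtain ⟨h1, h2, h3⟩ := mem_Mat.1 hΘ
    ext ⟨u, w⟩
    rw [mem_image_pair]
    simp only [Finset.mem_filter, Finset.mem_product, Prod.map]
    constructor
    · rintro ⟨x, y, h, rfl, rfl⟩
      exact h.2
    · intro h
      obtain ⟨hu, hw⟩ := h1 u w h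
      obtain ⟨x, hx, rfl⟩ := Finset.mem_image.1 hu
      obtain ⟨y, hy, rfl⟩ := Finset.mem_image.1 hw
      exact ⟨x, y, ⟨⟨hx, hy⟩, h⟩, rfl, rfl⟩
  · intro Θ _
    rfl
end

lemma map_inj_on {p : ℕ → ℕ} : ∀ {u v : W}, (∀ x ∈ u, ∀ y ∈ v, p x = p y → x = y) →
    u.map p = v.map p → u = v
  | [], [], _, _ => rfl
  | [], _ :: _, _, h => by simp at h
  | _ :: _, [], _, h => by simp at h
  | x :: u, y :: v, hp, h => by
    simp only [List.map_cons, List.cons.injEq] at h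
    rw [hp x (by simp) y (by simp) h.1,
      map_inj_on (fun x hx y hy => hp x (by simp [hx]) y (by simp [hy])) h.2]

lemma Park_wordOfSet {G : Finset W} (hG : Good G) (hp : ∀ x ∈ wordOfSet G, 1 ≤ x) :
    Park (wordOfSet G) = wordOfSet (G.image (List.map (pk (wordOfSet G)))) ∧
      Good (G.image (List.map (pk (wordOfSet G)))) := by
  have := wordOfSet_map hG (f := pk (wordOfSet G))
    (fun x hx y hy h => pk_lt hx (hp x hx) h)
  exact ⟨by rw [Park_eq hp, this.1], this.2⟩

lemma shift_eq (b : W) (m : ℕ) :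
    (shiftF m (LR b)).toFinset = (LR b).toFinset.image (shiftW m) := by
  ext w; simp [shiftF]

lemma good_shift {G : Finset W} (hG : Good G) (m : ℕ) :
    wordOfSet (G.image (shiftW m)) = shiftW m (wordOfSet G) ∧ Good (G.image (shiftW m)) :=
  wordOfSet_map hG (f := (· + m)) (fun x _ y _ h => by simpa using h)

lemma letter_mem {a : W} {S : Finset W} (h : S ⊆ (LR a).toFinset) {x : ℕ}
    (hx : x ∈ wordOfSet S) : x ∈ a := by
  rw [← subWord_eq h] at hx
  exact (subWord_sublist a S).subset hx

lemma sepW {a b : W} (ha : IsPF a) (hb : IsPF b) :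
    SepW a.length (LR a).toFinset ((LR b).toFinset.image (shiftW a.length)) := by
  constructor
  · intro u hu
    exact ⟨((LR_good a).1 u hu).1,
      fun x hx => pf_le ha x (letter_mem (Finset.Subset.refl _) (mem_wordOfSet.2 ⟨u, hu, hx⟩))⟩
  · intro w hw
    obtain ⟨v, hv, rfl⟩ := Finset.mem_image.1 hw
    refine ⟨by simpa [shiftW] using ((LR_good b).1 v hv).1, ?_⟩
    intro x hx
    obtain ⟨y, hy, rfl⟩ := List.mem_map.1 hx
    have := hb.1 y (letter_mem (Finset.Subset.refl _) (mem_wordOfSet.2 ⟨v, hv, hy⟩))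
    omega

lemma key {N : Type} [AddCommMonoid N] {a b : W} (ha : IsPF a) (hb : IsPF b) {A B : Finset W}
    (hA : A ⊆ (LR a).toFinset) (hB : B ⊆ (LR b).toFinset) (g : W → N) :
    ∑ Θ ∈ Rset (Park (subWord a A)) (Park (subWord b B)),
      g (mTheta (Park (subWord a A)) (Park (subWord b B)) Θ) =
    ∑ Θ ∈ Mat A (B.image (shiftW a.length)),
      g (Park (wordOfSet (glueSet A (B.image (shiftW a.length)) Θ))) := by
  have gA := (LR_good a).subset hA
  have gB := (LR_good b).subset hB
  have gB' := good_shift gB a.length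
  have sub := subWord_sublist a A
  have hs : SepW a.length A (B.image (shiftW a.length)) :=
    (sepW ha hb).mono hA (Finset.image_subset_image hB)
  rw [subWord_eq hA] at sub
  rw [subWord_eq hA, subWord_eq hB]
  have lA : ∀ x ∈ wordOfSet A, 1 ≤ x ∧ x ≤ a.length := fun x hx =>
    ⟨ha.1 x (letter_mem hA hx), pf_le ha x (letter_mem hA hx)⟩
  have lB : ∀ x ∈ wordOfSet B, 1 ≤ x := fun x hx => hb.1 x (letter_mem hB hx)
  obtain ⟨pA, gPA⟩ := Park_wordOfSet gA (fun x hx => (lA x hx).1)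
  obtain ⟨pB, gPB⟩ := Park_wordOfSet gB lB
  have lenA : (Park (wordOfSet A)).length = (wordOfSet A).length := by
    rw [Park_eq (fun x hx => (lA x hx).1)]; simp
  set u := wordOfSet A with hu
  set v := wordOfSet B with hv
  set c := u ++ shiftW a.length v with hc
  have cpos : ∀ x ∈ c, 1 ≤ x := by
    intro x hx
    rcases List.mem_append.1 hx with h | h
    · exact (lA x h).1
    · obtain ⟨y, hy, rfl⟩ := List.mem_map.1 h
      have := lB y hy
      omega
  have cinj : ∀ x ∈ c, ∀ y ∈ c, pk c x = pk c y → x = y := by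
    intro x hx y hy h
    rcases lt_trichotomy x y with h' | h' | h'
    · have := pk_lt hx (cpos x hx) h'; omega
    · exact h'
    · have := pk_lt hy (cpos y hy) h'; omega
  have eA : A.image (List.map (pk u)) = A.image (List.map (pk c)) := by
    apply Finset.image_congr
    intro w hw
    apply List.map_congr_left
    intro x hx
    exact (pk_left lB (lA x (mem_wordOfSet.2 ⟨w, hw, hx⟩)).2).symm
  have eB : (B.image (List.map (pk v))).image (shiftW u.length) =
      (B.image (shiftW a.length)).image (List.map (pk c)) := by
    rw [Finset.image_image, Finset.image_image]
    apply Finset.image_congr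
    intro w hw
    simp only [Function.comp, shiftW, List.map_map]
    apply List.map_congr_left
    intro x hx
    exact (pk_right (fun x hx => (lA x hx).2) lB sub.length_le (sub_count ha sub)
      (lB x (mem_wordOfSet.2 ⟨w, hw, hx⟩))).symm
  have cA : ∀ w ∈ A, ∀ x ∈ w, x ∈ c := fun w hw x hx =>
    List.mem_append_left _ (mem_wordOfSet.2 ⟨w, hw, hx⟩)
  have cB : ∀ w ∈ B.image (shiftW a.length), ∀ x ∈ w, x ∈ c := by
    intro w hw x hx
    apply List.mem_append_right
    rw [hv, ← gB'.1]
    exact mem_wordOfSet.2 ⟨w, hw, hx⟩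
  have iA : ∀ w ∈ A, ∀ w' ∈ A, w.map (pk c) = w'.map (pk c) → w = w' :=
    fun w hw w' hw' h => map_inj_on
      (fun x hx y hy => cinj x (cA w hw x hx) y (cA w' hw' y hy)) h
  have iB : ∀ w ∈ B.image (shiftW a.length), ∀ w' ∈ B.image (shiftW a.length),
      w.map (pk c) = w'.map (pk c) → w = w' :=
    fun w hw w' hw' h => map_inj_on
      (fun x hx y hy => cinj x (cB w hw x hx) y (cB w' hw' y hy)) h
  have LA : (LR (Park u)).toFinset = A.image (List.map (pk c)) := by
    rw [pA, LRset_wordOfSet gPA, eA]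
  have LB : (shiftF (Park u).length (LR (Park v))).toFinset =
      (B.image (shiftW a.length)).image (List.map (pk c)) := by
    rw [shift_eq, pB, LRset_wordOfSet gPB, lenA, eB]
  have R : Rset (Park u) (Park v) =
      Mat (A.image (List.map (pk c))) ((B.image (shiftW a.length)).image (List.map (pk c))) := by
    rw [← LA, ← LB]; rfl
  rw [R, sum_Mat_image iA iB]
  apply Finset.sum_congr rfl
  intro Θ hΘ
  congr 1
  unfold mTheta
  rw [LA, LB, glue_image (fun _ _ => List.map_append) iA iB hΘ]
  have hperm : (wordOfSet (glueSet A (B.image (shiftW a.length)) Θ)).Perm c := by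
    rw [← Multiset.coe_eq_coe, coe_wordOfSet, sum_glue hs hΘ, ← coe_wordOfSet, ← coe_wordOfSet,
      gB'.1]
    rfl
  have gG := good_glue hs hΘ gA gB'.2
  rw [(Park_wordOfSet gG (fun x hx => cpos x (hperm.subset hx))).1, pk_perm hperm]

lemma deltaF_sum (K : Type) [Field K] {ι : Type} (s : Finset ι) (f : ι → W) :
    deltaF K (∑ i ∈ s, Mb K (f i)) = ∑ i ∈ s, deltaSingle K (f i) := by
  unfold deltaF
  rw [← Finsupp.sum_finsetSum_index]
  · apply Finset.sum_congr rfl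
    intro i _
    simp [Mb]
  · simp
  · intro a x y
    exact add_smul _ _ _

lemma sum_single2 (K : Type) [Field K] {ι : Type} (s : Finset ι) (f : ι → W × W)
    (h : W × W → FW2 K) :
    (∑ i ∈ s, Finsupp.single (f i) (1 : K)).sum (fun p c => c • h p) = ∑ i ∈ s, h (f i) := by
  rw [← Finsupp.sum_finsetSum_index]
  · apply Finset.sum_congr rfl
    intro i _
    simp
  · simp
  · intro a x y
    exact add_smul _ _ _

lemma star2F_sum (K : Type) [Field K] {ι κ : Type} (s : Finset ι) (f : ι → W × W)
    (t : Finset κ) (g : κ → W × W) :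
    star2F K (∑ i ∈ s, Finsupp.single (f i) 1) (∑ j ∈ t, Finsupp.single (g j) 1) =
      ∑ i ∈ s, ∑ j ∈ t, star2Single K (f i) (g j) := by
  unfold star2F
  have : ∀ (x y : FW2 K), (x.sum fun p cp => y.sum fun q cq => (cp * cq) • star2Single K p q) =
      x.sum (fun p cp => cp • (y.sum fun q cq => cq • star2Single K p q)) := by
    intro x y
    simp only [Finsupp.smul_sum, smul_smul]
  rw [this, sum_single2]
  apply Finset.sum_congr rfl
  intro i _
  rw [sum_single2]

lemma deltaF_Mb (K : Type) [Field K] (a : W) : deltaF K (Mb K a) = deltaSingle K a := by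
  simp [deltaF, Mb]

lemma starF_Mb (K : Type) [Field K] (a b : W) : starF K (Mb K a) (Mb K b) = mulSingle K a b := by
  simp [starF, Mb]

lemma deltaSingle_wordOfSet (K : Type) [Field K] {G : Finset W} (hG : Good G) :
    deltaSingle K (wordOfSet G) = ∑ S ∈ G.powerset,
      Finsupp.single (Park (wordOfSet S), Park (wordOfSet (G \ S))) 1 := by
  unfold deltaSingle
  rw [LRset_wordOfSet hG]
  apply Finset.sum_congr rfl
  intro S hS
  rw [subWord_eq, subWord_eq]
  · rw [LRset_wordOfSet hG]; exact Finset.sdiff_subset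
  · rw [LRset_wordOfSet hG]; exact Finset.mem_powerset.1 hS

lemma shiftW_inj (m : ℕ) : Function.Injective (shiftW m) :=
  List.map_injective_iff.2 (fun x y h => by simpa using h)

lemma sum_powerset_shift {N : Type} [AddCommMonoid N] (Z : Finset W) (m : ℕ)
    (f : Finset W → N) : ∑ B ∈ (Z.image (shiftW m)).powerset, f B =
      ∑ B ∈ Z.powerset, f (B.image (shiftW m)) := by
  have : (Z.image (shiftW m)).powerset = Z.powerset.image (fun B => B.image (shiftW m)) := by
    ext B
    simp only [Finset.mem_powerset, Finset.mem_image, Finset.subset_image_iff]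
  rw [this, Finset.sum_image]
  intro x _ y _ h
  exact Finset.image_injective (shiftW_inj m) h

/-- For all parking functions `a`, `b`:
`Δ(M_a ⋆ M_b) = Δ(M_a) ⋆ Δ(M_b)`, where the right-hand product is the
componentwise product on the tensor square (realized on the free module on
pairs of words). -/
theorem stmt6 (K : Type) [Field K] [CharZero K] (a b : W)
    (ha : IsPF a) (hb : IsPF b) :
    deltaF K (starF K (Mb K a) (Mb K b)) =
      star2F K (deltaF K (Mb K a)) (deltaF K (Mb K b)) := by

  have hs := sepW ha hb
  rw [starF_Mb, deltaF_Mb, deltaF_Mb]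
  unfold mulSingle
  rw [deltaF_sum]
  have hR : Rset a b = Mat (LR a).toFinset ((LR b).toFinset.image (shiftW a.length)) := by
    rw [← shift_eq]; rfl
  have hL : ∀ Θ ∈ Rset a b, deltaSingle K (mTheta a b Θ) =
      ∑ S ∈ (glueSet (LR a).toFinset ((LR b).toFinset.image (shiftW a.length)) Θ).powerset,
        Finsupp.single (Park (wordOfSet S), Park (wordOfSet
          (glueSet (LR a).toFinset ((LR b).toFinset.image (shiftW a.length)) Θ \ S))) 1 := by
    intro Θ hΘ
    rw [hR] at hΘ
    unfold mTheta
    rw [shift_eq]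
    exact deltaSingle_wordOfSet K
      (good_glue hs hΘ (LR_good a) (good_shift (LR_good b) a.length).2)
  rw [Finset.sum_congr rfl hL, hR,
    main_bij hs (fun S T => Finsupp.single (Park (wordOfSet S), Park (wordOfSet T)) (1 : K))]
  unfold deltaSingle
  rw [star2F_sum]
  apply Finset.sum_congr rfl
  intro A hA
  rw [Finset.mem_powerset] at hA
  rw [sum_powerset_shift]
  apply Finset.sum_congr rfl
  intro B hB
  rw [Finset.mem_powerset] at hB
  unfold star2Single
  simp only []
  rw [key ha hb hA hB (fun w => ∑ Θ' ∈ Rset (Park (subWord a ((LR a).toFinset \ A)))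
      (Park (subWord b ((LR b).toFinset \ B))),
      Finsupp.single (w, mTheta (Park (subWord a ((LR a).toFinset \ A)))
      (Park (subWord b ((LR b).toFinset \ B))) Θ') (1 : K))]
  apply Finset.sum_congr rfl
  intro Θ₁ _
  rw [key ha hb Finset.sdiff_subset Finset.sdiff_subset (fun w => Finsupp.single
    (Park (wordOfSet (glueSet A (B.image (shiftW a.length)) Θ₁)), w) (1 : K)),
    Finset.image_sdiff _ _ (shiftW_inj a.length)]
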